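/- arXiv:2302.07075 — 2 statements merged into one kernel-verified Lean document; each statement's English description precedes it below -/
import Mathlib

section
/- Let (z, ρ) be a solution of the meridian-plane equations of motion with ż(0) = ρ̇(0) = 0, and suppose T > 0 is the minimal positive period of the pair (z, ρ) (i.e., z and ρ are both T-periodic, and no T' with 0 < T' < T is a common period). Then the second static point differs from the first: (z(T/2), ρ(T/2)) ≠ (z(0), ρ(0)). -/
/-- Right-hand side of the `z` equation of motion in the meridian plane. -/
noncomputable def fZ (z ρ : ℝ) : ℝ :=
  -3 * z * ρ * (1 / ρ - ρ / (z ^ 2 + ρ ^ 2) ^ ((3 : ℝ) / 2)) / (z ^ 2 + ρ ^ 2) ^ ((5 : ℝ) / 2)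

/-- Right-hand side of the `ρ` equation of motion in the meridian plane. -/
noncomputable def gR (z ρ : ℝ) : ℝ :=
  (1 / ρ ^ 2 - 3 * ρ ^ 2 / (z ^ 2 + ρ ^ 2) ^ ((5 : ℝ) / 2)
      + 1 / (z ^ 2 + ρ ^ 2) ^ ((3 : ℝ) / 2))
    * (1 / ρ - ρ / (z ^ 2 + ρ ^ 2) ^ ((3 : ℝ) / 2))

/-- `(z, ρ)` is a solution of the meridian-plane equations of motion:
twice continuously differentiable, `ρ > 0` everywhere, and
`z̈ = fZ (z, ρ)`, `ρ̈ = gR (z, ρ)`. -/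
def IsSolution (z ρ : ℝ → ℝ) : Prop :=
  ContDiff ℝ 2 z ∧ ContDiff ℝ 2 ρ ∧ (∀ t, 0 < ρ t) ∧
    (∀ t, deriv (deriv z) t = fZ (z t) (ρ t)) ∧
    (∀ t, deriv (deriv ρ) t = gR (z t) (ρ t))

/-- Two integral curves of a vector field that is `C¹` along one of them agree everywhere once they
agree at time `0`. -/
theorem eq_of_hasDerivAt_of_contDiffAt {E : Type*} [NormedAddCommGroup E] [NormedSpace ℝ E]
    {v : E → E} {x y : ℝ → E} (hv : ∀ t, ContDiffAt ℝ 1 v (x t))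
    (hx : ∀ t, HasDerivAt x (v (x t)) t) (hy : ∀ t, HasDerivAt y (v (y t)) t)
    (h0 : x 0 = y 0) : x = y := by
  have hxc : Continuous x := continuous_iff_continuousAt.2 fun t => (hx t).continuousAt
  have hyc : Continuous y := continuous_iff_continuousAt.2 fun t => (hy t).continuousAt
  have hclopen : IsClopen {t | x t = y t} := by
    refine ⟨isClosed_eq hxc hyc, isOpen_iff_mem_nhds.2 fun t ht => ?_⟩
    obtain ⟨K, s, hs, hK⟩ := (hv t).exists_lipschitzOnWith
    have hs' : s ∈ nhds (y t) := ht ▸ hs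
    exact ODE_solution_unique_of_eventually (v := fun _ => v) (s := fun _ => s)
      (Filter.Eventually.of_forall fun _ => hK)
      ((hxc.continuousAt.eventually_mem hs).mono fun r hr => ⟨hx r, hr⟩)
      ((hyc.continuousAt.eventually_mem hs').mono fun r hr => ⟨hy r, hr⟩) ht
  funext t
  exact (hclopen.eq_univ ⟨0, h0⟩).ge (Set.mem_univ t)

/-- The first-order vector field on the phase space of `((z, ρ), (ż, ρ̇))`. -/
noncomputable def phaseField (p : (ℝ × ℝ) × (ℝ × ℝ)) : (ℝ × ℝ) × (ℝ × ℝ) :=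
  (p.2, (fZ p.1.1 p.1.2, gR p.1.1 p.1.2))

theorem contDiffAt_phaseField {p : (ℝ × ℝ) × (ℝ × ℝ)} (hp : 0 < p.1.2) :
    ContDiffAt ℝ 1 phaseField p := by
  have hr : p.1.1 ^ 2 + p.1.2 ^ 2 ≠ 0 := by positivity
  have hpow (a : ℝ) : (p.1.1 ^ 2 + p.1.2 ^ 2) ^ a ≠ 0 := by positivity
  have hz : ContDiffAt ℝ 1 (fun q : (ℝ × ℝ) × (ℝ × ℝ) => q.1.1) p := by fun_prop
  have hρ : ContDiffAt ℝ 1 (fun q : (ℝ × ℝ) × (ℝ × ℝ) => q.1.2) p := by fun_prop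
  have hR (a : ℝ) : ContDiffAt ℝ 1
      (fun q : (ℝ × ℝ) × (ℝ × ℝ) => (q.1.1 ^ 2 + q.1.2 ^ 2) ^ a) p :=
    ((hz.pow 2).add (hρ.pow 2)).rpow_const_of_ne hr
  have hc (c : ℝ) : ContDiffAt ℝ 1 (fun _ : (ℝ × ℝ) × (ℝ × ℝ) => c) p := contDiffAt_const
  have hB := ((hc 1).div hρ hp.ne').sub (hρ.div (hR (3 / 2)) (hpow _))
  refine contDiffAt_snd.prodMk (ContDiffAt.prodMk ?_ ?_)
  · exact ((((hc (-3)).mul hz).mul hρ).mul hB).div (hR (5 / 2)) (hpow _)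
  · exact ((((hc 1).div (hρ.pow 2) (pow_ne_zero 2 hp.ne')).sub
      (((hc 3).mul (hρ.pow 2)).div (hR (5 / 2)) (hpow _))).add
      ((hc 1).div (hR (3 / 2)) (hpow _))).mul hB

theorem IsSolution.hasDerivAt_phase {z ρ : ℝ → ℝ} (h : IsSolution z ρ) (t : ℝ) :
    HasDerivAt (fun t => ((z t, ρ t), (deriv z t, deriv ρ t)))
      (phaseField ((z t, ρ t), (deriv z t, deriv ρ t))) t := by
  obtain ⟨hz, hρ, -, hz2, hρ2⟩ := h
  have hz' : Differentiable ℝ (deriv z) := hz.differentiable_deriv_two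
  have hρ' : Differentiable ℝ (deriv ρ) := hρ.differentiable_deriv_two
  refine ((hz.differentiable (by norm_num) t).hasDerivAt.prodMk
    (hρ.differentiable (by norm_num) t).hasDerivAt).prodMk ?_
  have := (hz' t).hasDerivAt.prodMk (hρ' t).hasDerivAt
  rwa [hz2, hρ2] at this

theorem IsSolution.eq_of_initial_eq {z ρ w σ : ℝ → ℝ} (h : IsSolution z ρ) (h' : IsSolution w σ)
    (hz : z 0 = w 0) (hρ : ρ 0 = σ 0) (hdz : deriv z 0 = deriv w 0)
    (hdρ : deriv ρ 0 = deriv σ 0) (t : ℝ) : z t = w t ∧ ρ t = σ t := by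
  have key := congrFun (eq_of_hasDerivAt_of_contDiffAt
    (fun t => contDiffAt_phaseField (h.2.2.1 t)) h.hasDerivAt_phase h'.hasDerivAt_phase
    (by simp only [hz, hρ, hdz, hdρ])) t
  simp only [Prod.mk.injEq] at key
  exact key.1

theorem IsSolution.comp_neg {z ρ : ℝ → ℝ} (h : IsSolution z ρ) :
    IsSolution (fun t => z (-t)) (fun t => ρ (-t)) := by
  obtain ⟨hz, hρ, hpos, hz2, hρ2⟩ := h
  have hdd (f : ℝ → ℝ) (t : ℝ) : deriv (deriv fun t => f (-t)) t = deriv (deriv f) (-t) := by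
    have : (deriv fun t => f (-t)) = fun t => -deriv f (-t) := funext fun t => deriv_comp_neg f t
    rw [this, deriv.fun_neg, deriv_comp_neg (deriv f), neg_neg]
  exact ⟨hz.comp contDiff_neg, hρ.comp contDiff_neg, fun t => hpos (-t),
    fun t => by rw [hdd, hz2], fun t => by rw [hdd, hρ2]⟩

theorem IsSolution.comp_add_const {z ρ : ℝ → ℝ} (h : IsSolution z ρ) (a : ℝ) :
    IsSolution (fun t => z (t + a)) (fun t => ρ (t + a)) := by
  obtain ⟨hz, hρ, hpos, hz2, hρ2⟩ := h
  have hdd (f : ℝ → ℝ) (t : ℝ) :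
      deriv (deriv fun t => f (t + a)) t = deriv (deriv f) (t + a) := by
    have : (deriv fun t => f (t + a)) = fun t => deriv f (t + a) :=
      funext fun t => deriv_comp_add_const f a t
    rw [this, deriv_comp_add_const (deriv f)]
  have ha : ContDiff ℝ 2 fun t : ℝ => t + a := by fun_prop
  exact ⟨hz.comp ha, hρ.comp ha, fun t => hpos (t + a),
    fun t => by rw [hdd, hz2], fun t => by rw [hdd, hρ2]⟩

/-- A solution starting from rest is even in time. -/
theorem IsSolution.even_of_rest {z ρ : ℝ → ℝ} (h : IsSolution z ρ) (hz0 : deriv z 0 = 0)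
    (hρ0 : deriv ρ 0 = 0) (t : ℝ) : z t = z (-t) ∧ ρ t = ρ (-t) :=
  h.eq_of_initial_eq h.comp_neg (by simp) (by simp) (by simp [deriv_comp_neg, hz0])
    (by simp [deriv_comp_neg, hρ0]) t

/-- An even `T`-periodic function has vanishing derivative at `T / 2`. -/
theorem deriv_half_period_eq_zero {f : ℝ → ℝ} {T : ℝ} (heven : ∀ t, f t = f (-t))
    (hper : ∀ t, f (t + T) = f t) : deriv f (T / 2) = 0 := by
  have hrefl : (fun t => f (T - t)) = f := by
    funext t
    rw [heven t, ← hper (-t)]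
    ring_nf
  have hd := deriv_comp_const_sub f T (T / 2)
  rw [hrefl, sub_half] at hd
  linarith

/-- For a solution starting from rest with minimal positive period `T`,
the static point at `T/2` differs from the one at `0`. -/
theorem second_static_point_is_distinct (z ρ : ℝ → ℝ) (hsol : IsSolution z ρ)
    (hz0 : deriv z 0 = 0) (hρ0 : deriv ρ 0 = 0) (T : ℝ) (hT : 0 < T)
    (hzper : ∀ t : ℝ, z (t + T) = z t) (hρper : ∀ t : ℝ, ρ (t + T) = ρ t)
    (hmin : ∀ T' : ℝ, 0 < T' → T' < T →
      ¬((∀ t : ℝ, z (t + T') = z t) ∧ (∀ t : ℝ, ρ (t + T') = ρ t))) :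
    (z (T / 2), ρ (T / 2)) ≠ (z 0, ρ 0) := by
  intro heq
  obtain ⟨hzT, hρT⟩ := Prod.mk.inj heq
  have heven := hsol.even_of_rest hz0 hρ0
  have hshift := (hsol.comp_add_const (T / 2)).eq_of_initial_eq hsol (by simpa using hzT)
    (by simpa using hρT)
    (by rw [deriv_comp_add_const, zero_add, hz0,
      deriv_half_period_eq_zero (fun t => (heven t).1) hzper])
    (by rw [deriv_comp_add_const, zero_add, hρ0,
      deriv_half_period_eq_zero (fun t => (heven t).2) hρper])
  exact hmin (T / 2) (half_pos hT) (half_lt_self hT)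
    ⟨fun t => (hshift t).1, fun t => (hshift t).2⟩
end

section
/- Let (z, ρ) be a solution of the meridian-plane equations of motion with ż(0) = ρ̇(0) = 0 whose minimal positive period is T > 0 and which is symmetric with respect to the equatorial plane, i.e. z(T/2) = −z(0) and ρ(T/2) = ρ(0). Then t = T/4 is the only time in the half-open interval [0, T/2) at which z(t) = 0 and ρ̇(t) = 0. -/
/-- Right-hand side of the meridian-plane equations as a first-order system in the
variables `((z, ρ), (ż, ρ̇))`. -/
noncomputable def meridianField (p : (ℝ × ℝ) × ℝ × ℝ) : (ℝ × ℝ) × ℝ × ℝ :=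
  (p.2, fZ p.1.1 p.1.2, gR p.1.1 p.1.2)

theorem contDiffAt_meridianField {p : (ℝ × ℝ) × ℝ × ℝ} (hp : 0 < p.1.2) :
    ContDiffAt ℝ 1 meridianField p := by
  have hr : p.1.1 ^ 2 + p.1.2 ^ 2 ≠ 0 := by positivity
  have hpow (a : ℝ) : (p.1.1 ^ 2 + p.1.2 ^ 2) ^ a ≠ 0 :=
    (Real.rpow_pos_of_pos (by positivity) a).ne'
  have hz : ContDiffAt ℝ 1 (fun q : (ℝ × ℝ) × ℝ × ℝ => q.1.1) p := by fun_prop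
  have hρ : ContDiffAt ℝ 1 (fun q : (ℝ × ℝ) × ℝ × ℝ => q.1.2) p := by fun_prop
  have hrpow (a : ℝ) :
      ContDiffAt ℝ 1 (fun q : (ℝ × ℝ) × ℝ × ℝ => (q.1.1 ^ 2 + q.1.2 ^ 2) ^ a) p :=
    ((hz.pow 2).add (hρ.pow 2)).rpow_const_of_ne hr
  have hcommon : ContDiffAt ℝ 1 (fun q : (ℝ × ℝ) × ℝ × ℝ =>
      1 / q.1.2 - q.1.2 / (q.1.1 ^ 2 + q.1.2 ^ 2) ^ ((3 : ℝ) / 2)) p :=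
    (contDiffAt_const.div hρ hp.ne').sub (hρ.div (hrpow _) (hpow _))
  refine contDiffAt_snd.prodMk (ContDiffAt.prodMk ?_ ?_)
  · exact (((contDiffAt_const.mul hz).mul hρ).mul hcommon).div (hrpow _) (hpow _)
  · exact (((contDiffAt_const.div (hρ.pow 2) (pow_ne_zero 2 hp.ne')).sub
      ((contDiffAt_const.mul (hρ.pow 2)).div (hrpow _) (hpow _))).add
      (contDiffAt_const.div (hrpow _) (hpow _))).mul hcommon

theorem fZ_neg (z ρ : ℝ) : fZ (-z) ρ = -fZ z ρ := by
  simp only [fZ, neg_sq]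
  ring

theorem gR_neg (z ρ : ℝ) : gR (-z) ρ = gR z ρ := by
  simp only [gR, neg_sq]

theorem differentiable_deriv_of_contDiff_two {u : ℝ → ℝ} (hu : ContDiff ℝ 2 u) :
    Differentiable ℝ (deriv u) :=
  ((contDiff_succ_iff_deriv (n := 1)).1 hu).2.2.differentiable one_ne_zero

namespace IsSolution

variable {z ρ z₁ ρ₁ z₂ ρ₂ : ℝ → ℝ}

theorem hasDerivAt (h : IsSolution z ρ) (t : ℝ) :
    HasDerivAt (fun s => ((z s, ρ s), deriv z s, deriv ρ s))
      (meridianField ((z t, ρ t), deriv z t, deriv ρ t)) t := by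
  obtain ⟨hz, hρ, -, hz'', hρ''⟩ := h
  have hz' := (differentiable_deriv_of_contDiff_two hz t).hasDerivAt
  have hρ' := (differentiable_deriv_of_contDiff_two hρ t).hasDerivAt
  rw [hz''] at hz'
  rw [hρ''] at hρ'
  exact ((hz.differentiable two_ne_zero t).hasDerivAt.prodMk
    (hρ.differentiable two_ne_zero t).hasDerivAt).prodMk (hz'.prodMk hρ')

theorem eq_of_initial (h₁ : IsSolution z₁ ρ₁) (h₂ : IsSolution z₂ ρ₂) (t₀ : ℝ)
    (hz : z₁ t₀ = z₂ t₀) (hρ : ρ₁ t₀ = ρ₂ t₀) (hz' : deriv z₁ t₀ = deriv z₂ t₀)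
    (hρ' : deriv ρ₁ t₀ = deriv ρ₂ t₀) : z₁ = z₂ ∧ ρ₁ = ρ₂ := by
  set x := fun s => ((z₁ s, ρ₁ s), deriv z₁ s, deriv ρ₁ s)
  set y := fun s => ((z₂ s, ρ₂ s), deriv z₂ s, deriv ρ₂ s)
  have hx : Continuous x :=
    continuous_iff_continuousAt.2 fun t => (h₁.hasDerivAt t).continuousAt
  have hy : Continuous y :=
    continuous_iff_continuousAt.2 fun t => (h₂.hasDerivAt t).continuousAt
  have hopen : IsOpen {t | x t = y t} := by
    refine isOpen_iff_mem_nhds.2 fun t (ht : x t = y t) => ?_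
    obtain ⟨K, s, hs, hK⟩ :=
      (contDiffAt_meridianField (p := x t) (h₁.2.2.1 t)).exists_lipschitzOnWith
    exact ODE_solution_unique_of_eventually (v := fun _ => meridianField) (s := fun _ => s)
      (Filter.Eventually.of_forall fun _ => hK)
      ((hx.continuousAt.eventually_mem hs).mono fun u hu => ⟨h₁.hasDerivAt u, hu⟩)
      ((hy.continuousAt.eventually_mem (ht ▸ hs)).mono fun u hu => ⟨h₂.hasDerivAt u, hu⟩) ht
  have huniv : {t | x t = y t} = Set.univ :=
    IsClopen.eq_univ ⟨isClosed_eq hx hy, hopen⟩ ⟨t₀, by simp [x, y, hz, hρ, hz', hρ']⟩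
  have key (t : ℝ) : x t = y t := Set.eq_univ_iff_forall.1 huniv t
  exact ⟨funext fun t => congrArg (fun p => p.1.1) (key t),
    funext fun t => congrArg (fun p => p.1.2) (key t)⟩

theorem comp_const_sub (h : IsSolution z ρ) (a : ℝ) :
    IsSolution (fun t => z (a - t)) (fun t => ρ (a - t)) := by
  obtain ⟨hz, hρ, hpos, hz'', hρ''⟩ := h
  refine ⟨hz.comp (by fun_prop), hρ.comp (by fun_prop), fun t => hpos _, fun t => ?_,
    fun t => ?_⟩
  · have hd : deriv (fun t => z (a - t)) = fun t => -deriv z (a - t) :=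
      funext fun t => deriv_comp_const_sub ..
    rw [hd, deriv.fun_neg, deriv_comp_const_sub, neg_neg, hz'']
  · have hd : deriv (fun t => ρ (a - t)) = fun t => -deriv ρ (a - t) :=
      funext fun t => deriv_comp_const_sub ..
    rw [hd, deriv.fun_neg, deriv_comp_const_sub, neg_neg, hρ'']

theorem comp_add_const_s11 (h : IsSolution z ρ) (a : ℝ) :
    IsSolution (fun t => z (t + a)) (fun t => ρ (t + a)) := by
  obtain ⟨hz, hρ, hpos, hz'', hρ''⟩ := h
  refine ⟨hz.comp (by fun_prop), hρ.comp (by fun_prop), fun t => hpos _, fun t => ?_,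
    fun t => ?_⟩
  · have hd : deriv (fun t => z (t + a)) = fun t => deriv z (t + a) :=
      funext fun t => deriv_comp_add_const ..
    rw [hd, deriv_comp_add_const, hz'']
  · have hd : deriv (fun t => ρ (t + a)) = fun t => deriv ρ (t + a) :=
      funext fun t => deriv_comp_add_const ..
    rw [hd, deriv_comp_add_const, hρ'']

theorem neg_left (h : IsSolution z ρ) : IsSolution (fun t => -z t) ρ := by
  obtain ⟨hz, hρ, hpos, hz'', hρ''⟩ := h
  refine ⟨hz.neg, hρ, hpos, fun t => ?_, fun t => by rw [hρ'', gR_neg]⟩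
  have hd : deriv (fun t => -z t) = fun t => -deriv z t := funext fun t => deriv.fun_neg
  rw [hd, deriv.fun_neg, hz'', fZ_neg]

/-- A solution at rest at time `a` is symmetric under time reversal about `a`. -/
theorem reflect_of_rest (h : IsSolution z ρ) {a : ℝ} (hz : deriv z a = 0)
    (hρ : deriv ρ a = 0) (t : ℝ) : z (2 * a - t) = z t ∧ ρ (2 * a - t) = ρ t := by
  have ha : 2 * a - a = a := by ring
  have := (h.comp_const_sub (2 * a)).eq_of_initial h a (by simp only [ha]) (by simp only [ha])
    (by rw [deriv_comp_const_sub, ha, hz, neg_zero])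
    (by rw [deriv_comp_const_sub, ha, hρ, neg_zero])
  exact ⟨congrFun this.1 t, congrFun this.2 t⟩

/-- A solution crossing the equatorial plane perpendicularly at time `a` is symmetric under
time reversal about `a` combined with reflection in that plane. -/
theorem reflect_of_perpendicular (h : IsSolution z ρ) {a : ℝ} (hz : z a = 0)
    (hρ : deriv ρ a = 0) (t : ℝ) : z (2 * a - t) = -z t ∧ ρ (2 * a - t) = ρ t := by
  have ha : 2 * a - a = a := by ring
  have := (h.comp_const_sub (2 * a)).eq_of_initial h.neg_left a
    (by simp only [ha, hz, neg_zero]) (by simp only [ha])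
    (by rw [deriv_comp_const_sub, ha, deriv.fun_neg])
    (by rw [deriv_comp_const_sub, ha, hρ, neg_zero])
  exact ⟨congrFun this.1 t, congrFun this.2 t⟩

end IsSolution

theorem deriv_eq_zero_of_reflect {u : ℝ → ℝ} {a : ℝ} (hu : ∀ t, u (2 * a - t) = u t) :
    deriv u a = 0 := by
  have h := deriv_comp_const_sub (f := u) (2 * a) a
  rw [funext hu, show 2 * a - a = a by ring] at h
  linarith

/-- For a symmetric solution starting from rest with minimal positive period `T`,
`t = T/4` is the only time in `[0, T/2)` at which `z(t) = 0` and `ρ̇(t) = 0`. -/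
theorem unique_perpendicular_crossing (z ρ : ℝ → ℝ) (hsol : IsSolution z ρ)
    (hz0 : deriv z 0 = 0) (hρ0 : deriv ρ 0 = 0) (T : ℝ) (hT : 0 < T)
    (hzper : ∀ t : ℝ, z (t + T) = z t) (hρper : ∀ t : ℝ, ρ (t + T) = ρ t)
    (hmin : ∀ T' : ℝ, 0 < T' → T' < T →
      ¬((∀ t : ℝ, z (t + T') = z t) ∧ (∀ t : ℝ, ρ (t + T') = ρ t)))
    (hzsym : z (T / 2) = -z 0) (hρsym : ρ (T / 2) = ρ 0) :
    ∀ t : ℝ, t ∈ Set.Ico 0 (T / 2) → ((z t = 0 ∧ deriv ρ t = 0) ↔ t = T / 4) := by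
  have heven (t : ℝ) : z (-t) = z t ∧ ρ (-t) = ρ t := by
    simpa using hsol.reflect_of_rest hz0 hρ0 t
  have hz' : deriv z (T / 2) = 0 := deriv_eq_zero_of_reflect fun t => by
    rw [show 2 * (T / 2) - t = -t + T by ring, hzper, (heven t).1]
  have hρ' : deriv ρ (T / 2) = 0 := deriv_eq_zero_of_reflect fun t => by
    rw [show 2 * (T / 2) - t = -t + T by ring, hρper, (heven t).2]
  have hshift := (hsol.comp_add_const_s11 (T / 2)).eq_of_initial hsol.neg_left 0
    (by simpa using hzsym) (by simpa using hρsym)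
    (by rw [deriv_comp_add_const, zero_add, hz', deriv.fun_neg, hz0, neg_zero])
    (by rw [deriv_comp_add_const, zero_add, hρ', hρ0])
  have hzshift (t : ℝ) : z (t + T / 2) = -z t := congrFun hshift.1 t
  have hρshift (t : ℝ) : ρ (t + T / 2) = ρ t := congrFun hshift.2 t
  rintro t ⟨ht0, htT⟩
  constructor
  · rintro ⟨hzt, hρt⟩
    have href := hsol.reflect_of_perpendicular hzt hρt
    have hz2 (s : ℝ) : z (s + 2 * t) = -z s := by
      rw [show s + 2 * t = 2 * t - -s by ring, (href _).1, (heven s).1]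
    have hρ2 (s : ℝ) : ρ (s + 2 * t) = ρ s := by
      rw [show s + 2 * t = 2 * t - -s by ring, (href _).2, (heven s).2]
    by_contra hne
    rcases lt_or_gt_of_ne hne with hlt | hgt
    · refine hmin (T / 2 - 2 * t) (by linarith) (by linarith) ⟨fun s => ?_, fun s => ?_⟩
      · have h₁ := hz2 (s + (T / 2 - 2 * t))
        rw [show s + (T / 2 - 2 * t) + 2 * t = s + T / 2 by ring, hzshift] at h₁
        linarith
      · have h₁ := hρ2 (s + (T / 2 - 2 * t))
        rw [show s + (T / 2 - 2 * t) + 2 * t = s + T / 2 by ring, hρshift] at h₁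
        exact h₁.symm
    · refine hmin (2 * t - T / 2) (by linarith) (by linarith) ⟨fun s => ?_, fun s => ?_⟩
      · have h₁ := hzshift (s + (2 * t - T / 2))
        rw [show s + (2 * t - T / 2) + T / 2 = s + 2 * t by ring, hz2] at h₁
        linarith
      · have h₁ := hρshift (s + (2 * t - T / 2))
        rw [show s + (2 * t - T / 2) + T / 2 = s + 2 * t by ring, hρ2] at h₁
        exact h₁.symm
  · rintro rfl
    constructor
    · have h := hzshift (-(T / 4))
      rw [show -(T / 4) + T / 2 = T / 4 by ring, (heven _).1] at h
      linarith
    · refine deriv_eq_zero_of_reflect fun t => ?_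
      rw [show 2 * (T / 4) - t = -t + T / 2 by ring, hρshift, (heven t).2]
end
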